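/- arXiv:2311.05747 — 6 statements merged into one kernel-verified Lean document; each statement's English description precedes it below -/
import Mathlib

section
/- Let γ > 0, set a = min(γ, 1/γ)/2 and b = 1 + a² − aγ, and let λ' ∈ [0, a/4]. Then for every N ≥ 1 and all P, Q ∈ ℝ^N, −a |P|² + b(a − γ)|Q|² + λ' |aP + bQ| · |P − aQ| ≤ −(a/8) ( |P|² + b |Q|² ). -/
/-- key pointwise quadratic-form estimate for the contraction of the
modified norm `|P|² + b|Q|²`, with `a = min(γ, 1/γ)/2`, `b = 1 + a² - aγ`,
and `λ' ∈ [0, a/4]`. -/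
theorem quadratic_contraction_estimate (γ : ℝ) (hγ : 0 < γ)
    (a b : ℝ) (ha : a = min γ γ⁻¹ / 2) (hb : b = 1 + a ^ 2 - a * γ)
    (lam' : ℝ) (hlam0 : 0 ≤ lam') (hlam : lam' ≤ a / 4)
    (N : ℕ) (hN : 1 ≤ N) (P Q : EuclideanSpace ℝ (Fin N)) :
    -a * ‖P‖ ^ 2 + b * (a - γ) * ‖Q‖ ^ 2 + lam' * ‖a • P + b • Q‖ * ‖P - a • Q‖
      ≤ -(a / 8) * (‖P‖ ^ 2 + b * ‖Q‖ ^ 2) := by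
  have ha0 : 0 < a := by rw [ha]; positivity
  have hγa : 2 * a ≤ γ := by linarith [min_le_left γ γ⁻¹]
  have haγ : a * γ ≤ 1 / 2 := by
    have h : a ≤ γ⁻¹ / 2 := by linarith [min_le_right γ γ⁻¹]
    calc a * γ ≤ γ⁻¹ / 2 * γ := by gcongr
      _ = 1 / 2 := by field_simp
  have ha_half : a ≤ 1 / 2 := by nlinarith
  have hb_half : 1 / 2 ≤ b := by nlinarith [sq_nonneg a]
  have hab : a ^ 2 + b ≤ 1 := by nlinarith
  have hsum : ‖a • P + b • Q‖ ≤ a * ‖P‖ + b * ‖Q‖ := by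
    refine (norm_add_le _ _).trans_eq ?_
    rw [norm_smul, norm_smul, Real.norm_of_nonneg ha0.le, Real.norm_of_nonneg (by linarith)]
  have hdiff : ‖P - a • Q‖ ≤ ‖P‖ + a * ‖Q‖ := by
    refine (norm_sub_le _ _).trans_eq ?_
    rw [norm_smul, Real.norm_of_nonneg ha0.le]
  have hp := norm_nonneg P
  have hq := norm_nonneg Q
  generalize ‖P‖ = p at *
  generalize ‖Q‖ = q at *
  have hcross : lam' * ‖a • P + b • Q‖ * ‖P - a • Q‖
      ≤ a / 4 * (a * p + b * q) * (p + a * q) := by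
    gcongr
  have hfriction : b * (a - γ) * q ^ 2 ≤ b * (-a) * q ^ 2 := by
    gcongr
    linarith
  have hpq : (a ^ 2 + b) * (p * q) ≤ p * q :=
    mul_le_of_le_one_left (mul_nonneg hp hq) hab
  have hbq : 1 / 2 * q ^ 2 ≤ b * q ^ 2 := by gcongr
  have hap : a * p ^ 2 ≤ 1 / 2 * p ^ 2 := by gcongr
  have haq : a * (b * q ^ 2) ≤ 1 / 2 * (b * q ^ 2) := by gcongr
  have hform : 1 / 4 * ((a * p + b * q) * (p + a * q)) ≤ 7 / 8 * (p ^ 2 + b * q ^ 2) := by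
    nlinarith [sq_nonneg (p - q)]
  have hscaled := mul_le_mul_of_nonneg_left hform ha0.le
  linarith
end

section
/- Let N ≥ 1, γ > 0, λ ≥ 0, and let F : ℝ^N → ℝ^N be Lipschitz with constant ℓ ≥ 0 such that λℓ ≤ min(γ, 1/γ)/8. Let x, v, x̃, ṽ : [0, ∞) → ℝ^N be differentiable and satisfy for all t ≥ 0: x'(t) = v(t), v'(t) = −(x(t) + γ v(t) + λ F(x(t))), x̃'(t) = ṽ(t), ṽ'(t) = −(x̃(t) + γ ṽ(t) + λ F(x̃(t))). Then for all t ≥ 0, |x(t) − x̃(t)|² + |v(t) − ṽ(t)|² ≤ 4 · exp( − min(γ, 1/γ) t / 8 ) · ( |x(0) − x̃(0)|² + |v(0) − ṽ(0)|² ). -/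
open scoped RealInnerProductSpace

/-- Differential form of Grönwall's inequality with a negative rate. -/
lemma le_exp_mul_of_hasDerivAt_le {f f' : ℝ → ℝ} {c : ℝ}
    (hf : ∀ t, 0 ≤ t → HasDerivAt f (f' t) t) (hle : ∀ t, 0 ≤ t → f' t ≤ -c * f t)
    {t : ℝ} (ht : 0 ≤ t) : f t ≤ Real.exp (-c * t) * f 0 := by
  have hd : ∀ s, 0 ≤ s → HasDerivAt (fun s => Real.exp (c * s) * f s)
      (Real.exp (c * s) * (c * 1) * f s + Real.exp (c * s) * f' s) s := fun s hs =>
    (((hasDerivAt_id s).const_mul c).exp).mul (hf s hs)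
  have hanti : AntitoneOn (fun s => Real.exp (c * s) * f s) (Set.Ici 0) := by
    refine antitoneOn_of_deriv_nonpos (convex_Ici 0)
      (fun s hs => (hd s hs).continuousAt.continuousWithinAt)
      (fun s hs => (hd s (interior_subset hs)).differentiableAt.differentiableWithinAt)
      fun s hs => ?_
    have hs' : 0 ≤ s := interior_subset hs
    rw [(hd s hs').deriv]
    nlinarith [hle s hs', Real.exp_pos (c * s)]
  have h := hanti Set.self_mem_Ici ht ht
  simp only [mul_zero, Real.exp_zero, one_mul] at h
  calc f t = Real.exp (-c * t) * (Real.exp (c * t) * f t) := by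
        rw [← mul_assoc, ← Real.exp_add]; simp
    _ ≤ Real.exp (-c * t) * f 0 := by gcongr

section Dissipation

variable {E : Type*} [NormedAddCommGroup E] [InnerProductSpace ℝ E]

/-- Dissipation of the twisted energy `‖q‖² + ‖p‖² + m ⟪q, p⟫` along `q̇ = p`,
`ṗ = -(q + γ p + g)` for a perturbation `g` that is small relative to `q`. -/
lemma twisted_energy_dissipation {γ m : ℝ} (hm : 0 < m) (hmγ : m ≤ γ) (hm1 : m * γ ≤ 1)
    {q p g : E} (hg : ‖g‖ ≤ m / 8 * ‖q‖) :
    2 * ⟪q, p⟫ + 2 * ⟪p, -(q + γ • p + g)⟫ + m * (⟪q, -(q + γ • p + g)⟫ + ⟪p, p⟫)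
      ≤ -(m / 8) * (‖q‖ ^ 2 + ‖p‖ ^ 2 + m * ⟪q, p⟫) := by
  have hm_le : m ≤ 1 := by nlinarith
  have hqp := abs_le.mp (abs_real_inner_le_norm q p)
  have hpg : -⟪p, g⟫ ≤ m / 8 * (‖q‖ * ‖p‖) := by
    have := (abs_le.mp (abs_real_inner_le_norm p g)).1
    nlinarith [mul_le_mul_of_nonneg_left hg (norm_nonneg p)]
  have hqg : -⟪q, g⟫ ≤ m / 8 * ‖q‖ ^ 2 := by
    have := (abs_le.mp (abs_real_inner_le_norm q g)).1
    nlinarith [mul_le_mul_of_nonneg_left hg (norm_nonneg q)]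
  simp only [inner_neg_right, inner_add_right, inner_smul_right, real_inner_self_eq_norm_sq,
    real_inner_comm q p]
  have hcross : -(m * γ - m ^ 2 / 8) * ⟪q, p⟫ ≤ m * γ * (‖q‖ * ‖p‖) := by
    have h0 : 0 ≤ m * γ - m ^ 2 / 8 := by nlinarith
    have hn : 0 ≤ ‖q‖ * ‖p‖ := by positivity
    nlinarith [mul_le_mul_of_nonneg_left hqp.1 h0, mul_nonneg (sq_nonneg m) hn]
  have hyoung : m * γ * (‖q‖ * ‖p‖) ≤ (γ * ‖p‖ ^ 2 + m * ‖q‖ ^ 2) / 2 := by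
    have h1 := mul_nonneg hm.le (sq_nonneg (‖q‖ - γ * ‖p‖))
    have h2 : m * γ * (γ * ‖p‖ ^ 2) ≤ 1 * (γ * ‖p‖ ^ 2) :=
      mul_le_mul_of_nonneg_right hm1 (mul_nonneg (hm.le.trans hmγ) (sq_nonneg _))
    nlinarith
  have hyoung' : m * (‖q‖ * ‖p‖) ≤ (γ * ‖p‖ ^ 2 + m * ‖q‖ ^ 2) / 2 := by
    have h1 := mul_nonneg hm.le (sq_nonneg (‖q‖ - ‖p‖))
    have h2 := mul_le_mul_of_nonneg_right hmγ (sq_nonneg ‖p‖)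
    nlinarith
  have hmqg := mul_le_mul_of_nonneg_left hqg hm.le
  have hmm : m * (m * ‖q‖ ^ 2) ≤ 1 * (m * ‖q‖ ^ 2) :=
    mul_le_mul_of_nonneg_right hm_le (by positivity)
  have hmp := mul_le_mul_of_nonneg_right hmγ (sq_nonneg ‖p‖)
  have hmq : 0 ≤ m * ‖q‖ ^ 2 := by positivity
  have hγp : 0 ≤ γ * ‖p‖ ^ 2 := mul_nonneg (hm.le.trans hmγ) (sq_nonneg _)
  linarith

lemma abs_real_inner_le_half_sq_add_sq (q p : E) : |⟪q, p⟫| ≤ (‖q‖ ^ 2 + ‖p‖ ^ 2) / 2 := by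
  nlinarith [abs_real_inner_le_norm q p, sq_nonneg (‖q‖ - ‖p‖)]

end Dissipation

/-- pathwise exponential contraction for the synchronously coupled
kinetic system when the interaction force `λF` is Lipschitz with constant
`λℓ ≤ min(γ, 1/γ)/8`. -/
theorem kinetic_pathwise_contraction (N : ℕ) (hN : 1 ≤ N) (γ : ℝ) (hγ : 0 < γ)
    (lam : ℝ) (hlam : 0 ≤ lam) (ell : ℝ) (hell : 0 ≤ ell)
    (F : EuclideanSpace ℝ (Fin N) → EuclideanSpace ℝ (Fin N))
    (hFlip : ∀ y z, ‖F y - F z‖ ≤ ell * ‖y - z‖)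
    (hsmall : lam * ell ≤ min γ γ⁻¹ / 8)
    (x v x' v' : ℝ → EuclideanSpace ℝ (Fin N))
    (hx : ∀ t, 0 ≤ t → HasDerivAt x (v t) t)
    (hv : ∀ t, 0 ≤ t → HasDerivAt v (-(x t + γ • v t + lam • F (x t))) t)
    (hx' : ∀ t, 0 ≤ t → HasDerivAt x' (v' t) t)
    (hv' : ∀ t, 0 ≤ t → HasDerivAt v' (-(x' t + γ • v' t + lam • F (x' t))) t) :
    ∀ t, 0 ≤ t →
      ‖x t - x' t‖ ^ 2 + ‖v t - v' t‖ ^ 2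
        ≤ 4 * Real.exp (-(min γ γ⁻¹) * t / 8)
            * (‖x 0 - x' 0‖ ^ 2 + ‖v 0 - v' 0‖ ^ 2) := by
  intro t ht
  set m := min γ γ⁻¹
  have hm : 0 < m := lt_min hγ (inv_pos.mpr hγ)
  have hmγ : m ≤ γ := min_le_left _ _
  have hm1 : m * γ ≤ 1 := by
    calc m * γ ≤ γ⁻¹ * γ := by gcongr; exact min_le_right _ _
      _ = 1 := inv_mul_cancel₀ hγ.ne'
  have hm_le : m ≤ 1 := by nlinarith
  have hq : ∀ s, 0 ≤ s → HasDerivAt (fun s => x s - x' s) (v s - v' s) s :=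
    fun s hs => (hx s hs).sub (hx' s hs)
  have hp : ∀ s, 0 ≤ s → HasDerivAt (fun s => v s - v' s)
      (-((x s - x' s) + γ • (v s - v' s) + lam • (F (x s) - F (x' s)))) s := fun s hs =>
    ((hv s hs).sub (hv' s hs)).congr_deriv (by module)
  have hforce : ∀ s, ‖lam • (F (x s) - F (x' s))‖ ≤ m / 8 * ‖x s - x' s‖ := fun s => by
    rw [norm_smul, Real.norm_of_nonneg hlam]
    calc lam * ‖F (x s) - F (x' s)‖ ≤ lam * (ell * ‖x s - x' s‖) := by gcongr; exact hFlip _ _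
      _ = lam * ell * ‖x s - x' s‖ := by ring
      _ ≤ m / 8 * ‖x s - x' s‖ := by gcongr
  have hdecay := le_exp_mul_of_hasDerivAt_le (c := m / 8)
    (fun s hs => ((hq s hs).norm_sq.add (hp s hs).norm_sq).add
      (((hq s hs).inner ℝ (hp s hs)).const_mul m))
    (fun s _ => twisted_energy_dissipation hm hmγ hm1 (hforce s)) ht
  simp only [Pi.add_apply] at hdecay
  rw [show -(m / 8) * t = -m * t / 8 by ring] at hdecay
  have hlower : (‖x t - x' t‖ ^ 2 + ‖v t - v' t‖ ^ 2) / 2 ≤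
      ‖x t - x' t‖ ^ 2 + ‖v t - v' t‖ ^ 2 + m * ⟪x t - x' t, v t - v' t⟫ := by
    have h := (abs_le.mp (abs_real_inner_le_half_sq_add_sq (x t - x' t) (v t - v' t))).1
    nlinarith [sq_nonneg ‖x t - x' t‖, sq_nonneg ‖v t - v' t‖]
  have hupper : ‖x 0 - x' 0‖ ^ 2 + ‖v 0 - v' 0‖ ^ 2 + m * ⟪x 0 - x' 0, v 0 - v' 0⟫ ≤
      2 * (‖x 0 - x' 0‖ ^ 2 + ‖v 0 - v' 0‖ ^ 2) := by
    have h := (abs_le.mp (abs_real_inner_le_half_sq_add_sq (x 0 - x' 0) (v 0 - v' 0))).2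
    nlinarith [sq_nonneg ‖x 0 - x' 0‖, sq_nonneg ‖v 0 - v' 0‖]
  have := mul_le_mul_of_nonneg_left hupper (Real.exp_pos (-m * t / 8)).le
  linarith
end

section
/- Let N ≥ 1, γ > 0, and let U : ℝ^N → ℝ be continuously differentiable with exp(−|x|²/2 − U(x)) locally integrable. Then for every smooth compactly supported g : ℝ^N × ℝ^N → ℝ, ∫∫ ( v · ∇_x g(x,v) − (x + ∇U(x) + γ v) · ∇_v g(x,v) + γ Δ_v g(x,v) ) · exp( −|x|²/2 − U(x) − |v|²/2 ) dx dv = 0. -/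
open MeasureTheory Finset

section Auxiliary

/-- Integration by parts against a compactly supported `C¹` function. -/
theorem integral_mul_fderiv_eq_neg_of_hasCompactSupport {E : Type*} [NormedAddCommGroup E]
    [NormedSpace ℝ E] [FiniteDimensional ℝ E] [MeasurableSpace E] [BorelSpace E]
    {μ : Measure E} [μ.IsAddHaarMeasure] {f h : E → ℝ} (hf : ContDiff ℝ 1 f)
    (hh : ContDiff ℝ 1 h) (hsupp : HasCompactSupport h) (w : E) :
    Integrable (fun p => f p * fderiv ℝ h p w) μ ∧
      Integrable (fun p => fderiv ℝ f p w * h p) μ ∧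
      ∫ p, f p * fderiv ℝ h p w ∂μ = -∫ p, fderiv ℝ f p w * h p ∂μ := by
  have hf' : Continuous fun p => fderiv ℝ f p w :=
    (hf.continuous_fderiv one_ne_zero).clm_apply continuous_const
  have hh' : Continuous fun p => fderiv ℝ h p w :=
    (hh.continuous_fderiv one_ne_zero).clm_apply continuous_const
  have hfh' : Integrable (fun p => f p * fderiv ℝ h p w) μ :=
    (hf.continuous.mul hh').integrable_of_hasCompactSupport (hsupp.fderiv_apply ℝ w).mul_left
  have hf'h : Integrable (fun p => fderiv ℝ f p w * h p) μ :=
    (hf'.mul hh.continuous).integrable_of_hasCompactSupport hsupp.mul_left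
  exact ⟨hfh', hf'h, integral_mul_fderiv_eq_neg_fderiv_mul_of_integrable hf'h hfh'
    ((hf.continuous.mul hh.continuous).integrable_of_hasCompactSupport hsupp.mul_left)
    (fun p _ => hf.differentiable one_ne_zero p) (fun p _ => hh.differentiable one_ne_zero p)⟩

variable {N : ℕ}

theorem hasDerivAt_comp_update {F : (Fin N → ℝ) → ℝ} (hF : Differentiable ℝ F)
    (x : Fin N → ℝ) (i : Fin N) (s : ℝ) :
    HasDerivAt (fun s => F (Function.update x i s))
      (fderiv ℝ F (Function.update x i s) (Pi.single i 1)) s :=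
  (hF _).hasFDerivAt.comp_hasDerivAt s (hasDerivAt_update x i s)

theorem hasDerivAt_comp_update_fst {F : (Fin N → ℝ) × (Fin N → ℝ) → ℝ} (hF : Differentiable ℝ F)
    (x v : Fin N → ℝ) (i : Fin N) (s : ℝ) :
    HasDerivAt (fun s => F (Function.update x i s, v))
      (fderiv ℝ F (Function.update x i s, v) (Pi.single i 1, 0)) s :=
  (hF _).hasFDerivAt.comp_hasDerivAt s ((hasDerivAt_update x i s).prodMk (hasDerivAt_const s v))

theorem hasDerivAt_comp_update_snd {F : (Fin N → ℝ) × (Fin N → ℝ) → ℝ} (hF : Differentiable ℝ F)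
    (x v : Fin N → ℝ) (i : Fin N) (s : ℝ) :
    HasDerivAt (fun s => F (x, Function.update v i s))
      (fderiv ℝ F (x, Function.update v i s) (0, Pi.single i 1)) s :=
  (hF _).hasFDerivAt.comp_hasDerivAt s ((hasDerivAt_const s x).prodMk (hasDerivAt_update v i s))

theorem iteratedDeriv_two_comp_update_snd {F : (Fin N → ℝ) × (Fin N → ℝ) → ℝ}
    (hF : ContDiff ℝ 2 F) (x v : Fin N → ℝ) (i : Fin N) :
    iteratedDeriv 2 (fun s => F (x, Function.update v i s)) (v i) =
      fderiv ℝ (fun q => fderiv ℝ F q (0, Pi.single i 1)) (x, v) (0, Pi.single i 1) := by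
  have hF' : Differentiable ℝ fun q => fderiv ℝ F q (0, Pi.single i 1) :=
    ((hF.fderiv_right (m := 1) (by norm_num)).clm_apply contDiff_const).differentiable one_ne_zero
  have hderiv : deriv (fun s => F (x, Function.update v i s)) =
      fun s => fderiv ℝ F (x, Function.update v i s) (0, Pi.single i 1) :=
    funext fun s => (hasDerivAt_comp_update_snd (hF.differentiable two_ne_zero) x v i s).deriv
  rw [iteratedDeriv_succ, iteratedDeriv_one, hderiv,
    (hasDerivAt_comp_update_snd hF' x v i (v i)).deriv, Function.update_eq_self]

/-- The unnormalised Gibbs density `exp(-|x|²/2 - U(x) - |v|²/2)`. -/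
noncomputable def gibbsDensity (U : (Fin N → ℝ) → ℝ) (p : (Fin N → ℝ) × (Fin N → ℝ)) : ℝ :=
  Real.exp (-(∑ i, (p.1 i) ^ 2) / 2 - U p.1 - (∑ i, (p.2 i) ^ 2) / 2)

theorem contDiff_gibbsDensity {U : (Fin N → ℝ) → ℝ} (hU : ContDiff ℝ 1 U) :
    ContDiff ℝ 1 (gibbsDensity U) := by
  unfold gibbsDensity
  fun_prop

theorem hasDerivAt_sum_sq_update (x : Fin N → ℝ) (i : Fin N) :
    HasDerivAt (fun s => ∑ j, (Function.update x i s j) ^ 2) (2 * x i) (x i) := by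
  have h : HasDerivAt (fun s => ∑ j, (Function.update x i s j) ^ 2)
      (∑ j, 2 * x j * (Pi.single i (1 : ℝ) : Fin N → ℝ) j) (x i) := by
    refine HasDerivAt.fun_sum fun j _ => ?_
    simpa using (hasDerivAt_pi.1 (hasDerivAt_update x i (x i)) j).fun_pow 2
  simpa [Pi.single_apply] using h

theorem fderiv_gibbsDensity_fst {U : (Fin N → ℝ) → ℝ} (hU : ContDiff ℝ 1 U)
    (p : (Fin N → ℝ) × (Fin N → ℝ)) (i : Fin N) :
    fderiv ℝ (gibbsDensity U) p (Pi.single i 1, 0) =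
      -(p.1 i + deriv (fun s => U (Function.update p.1 i s)) (p.1 i)) * gibbsDensity U p := by
  have hρ := hasDerivAt_comp_update_fst ((contDiff_gibbsDensity hU).differentiable one_ne_zero)
    p.1 p.2 i (p.1 i)
  have hU' := (hasDerivAt_comp_update (hU.differentiable one_ne_zero) p.1 i
    (p.1 i)).differentiableAt.hasDerivAt
  have hexp := ((((hasDerivAt_sum_sq_update p.1 i).neg.div_const 2).sub hU').sub_const
    ((∑ j, (p.2 j) ^ 2) / 2)).exp
  have := hρ.unique hexp
  simp only [Function.update_eq_self, Prod.mk.eta, Pi.sub_apply, Pi.neg_apply] at this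
  rw [this, gibbsDensity]
  ring

theorem fderiv_gibbsDensity_snd {U : (Fin N → ℝ) → ℝ} (hU : ContDiff ℝ 1 U)
    (p : (Fin N → ℝ) × (Fin N → ℝ)) (i : Fin N) :
    fderiv ℝ (gibbsDensity U) p (0, Pi.single i 1) = -p.2 i * gibbsDensity U p := by
  have hρ := hasDerivAt_comp_update_snd ((contDiff_gibbsDensity hU).differentiable one_ne_zero)
    p.1 p.2 i (p.2 i)
  have hexp := (((hasDerivAt_sum_sq_update p.2 i).div_const 2).const_sub
    (-(∑ j, (p.1 j) ^ 2) / 2 - U p.1)).exp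
  have := hρ.unique hexp
  simp only [Function.update_eq_self, Prod.mk.eta] at this
  rw [this, gibbsDensity]
  ring

/-- Directional derivatives of a `C²` function commute. -/
theorem fderiv_fderiv_apply_comm {E : Type*} [NormedAddCommGroup E] [NormedSpace ℝ E]
    {F : E → ℝ} (hF : ContDiff ℝ 2 F) (p a b : E) :
    fderiv ℝ (fun q => fderiv ℝ F q a) p b = fderiv ℝ (fun q => fderiv ℝ F q b) p a := by
  have hF' : DifferentiableAt ℝ (fderiv ℝ F) p :=
    (hF.fderiv_right (m := 1) (by norm_num)).differentiable one_ne_zero p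
  have key (c d : E) : fderiv ℝ (fun q => fderiv ℝ F q c) p d = fderiv ℝ (fderiv ℝ F) p d c := by
    simp [fderiv_clm_apply hF' (differentiableAt_const c)]
  rw [key, key]
  exact (hF.contDiffAt.isSymmSndFDerivAt (by simp)) b a

/-- In one coordinate, both the Hamiltonian part and the dissipative part of the kinetic Langevin
generator integrate to zero against a `C¹` density `ρ`, in divergence form. -/
theorem integral_langevin_divergence_form {E : Type*} [NormedAddCommGroup E]
    [NormedSpace ℝ E] [FiniteDimensional ℝ E] [MeasurableSpace E] [BorelSpace E]
    {μ : Measure E} [μ.IsAddHaarMeasure] {ρ G : E → ℝ} (hρ : ContDiff ℝ 1 ρ)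
    (hG : ContDiff ℝ 2 G) (hsupp : HasCompactSupport G) (γ : ℝ) (a b : E) :
    Integrable (fun p => fderiv ℝ ρ p a * fderiv ℝ G p b - fderiv ℝ ρ p b * fderiv ℝ G p a
      + γ * (ρ p * fderiv ℝ (fun q => fderiv ℝ G q b) p b
        + fderiv ℝ ρ p b * fderiv ℝ G p b)) μ ∧
    ∫ p, (fderiv ℝ ρ p a * fderiv ℝ G p b - fderiv ℝ ρ p b * fderiv ℝ G p a
      + γ * (ρ p * fderiv ℝ (fun q => fderiv ℝ G q b) p b
        + fderiv ℝ ρ p b * fderiv ℝ G p b)) ∂μ = 0 := by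
  have hG' (c : E) : ContDiff ℝ 1 fun q => fderiv ℝ G q c :=
    (hG.fderiv_right (m := 1) (by norm_num)).clm_apply contDiff_const
  have parts (c d : E) := integral_mul_fderiv_eq_neg_of_hasCompactSupport (μ := μ) hρ (hG' c)
    (hsupp.fderiv_apply ℝ c) d
  obtain ⟨-, hab, eab⟩ := parts b a
  obtain ⟨-, hba, eba⟩ := parts a b
  obtain ⟨hbb', hbb, ebb⟩ := parts b b
  have hcomm : ∫ p, ρ p * fderiv ℝ (fun q => fderiv ℝ G q b) p a ∂μ =
      ∫ p, ρ p * fderiv ℝ (fun q => fderiv ℝ G q a) p b ∂μ := by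
    simp_rw [fderiv_fderiv_apply_comm hG _ b a]
  refine ⟨(hab.sub hba).add ((hbb'.add hbb).const_mul γ), ?_⟩
  rw [integral_add (by exact hab.sub hba) (by exact (hbb'.add hbb).const_mul γ), integral_sub hab hba,
    integral_const_mul, integral_add hbb' hbb, ebb]
  linarith

end Auxiliary

/-- the Gibbs measure with density proportional to
`exp(-|x|²/2 - U(x) - |v|²/2)` is invariant for the kinetic Langevin generator
`L g = v·∇ₓg - (x + ∇U(x) + γv)·∇ᵥg + γΔᵥg`: the integral of `Lg` against the
Gibbs density vanishes for every smooth compactly supported `g`. -/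
theorem gibbs_invariant_kinetic_langevin (N : ℕ) (hN : 1 ≤ N) (γ : ℝ) (hγ : 0 < γ)
    (U : (Fin N → ℝ) → ℝ) (hU : ContDiff ℝ 1 U)
    (hloc : LocallyIntegrable
      (fun x : Fin N → ℝ => Real.exp (-(∑ i, (x i) ^ 2) / 2 - U x)) volume)
    (g : (Fin N → ℝ) → (Fin N → ℝ) → ℝ)
    (hg : ContDiff ℝ (⊤ : ℕ∞) (fun p : (Fin N → ℝ) × (Fin N → ℝ) => g p.1 p.2))
    (hgsupp : HasCompactSupport (fun p : (Fin N → ℝ) × (Fin N → ℝ) => g p.1 p.2)) :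
    ∫ p : (Fin N → ℝ) × (Fin N → ℝ),
      (∑ i, p.2 i * deriv (fun s => g (Function.update p.1 i s) p.2) (p.1 i)
        - ∑ i, (p.1 i + deriv (fun s => U (Function.update p.1 i s)) (p.1 i) + γ * p.2 i)
            * deriv (fun s => g p.1 (Function.update p.2 i s)) (p.2 i)
        + γ * ∑ i, iteratedDeriv 2 (fun s => g p.1 (Function.update p.2 i s)) (p.2 i))
      * Real.exp (-(∑ i, (p.1 i) ^ 2) / 2 - U p.1 - (∑ i, (p.2 i) ^ 2) / 2) = 0 := by
  let G : (Fin N → ℝ) × (Fin N → ℝ) → ℝ := fun p => g p.1 p.2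
  have hG : ContDiff ℝ 2 G := contDiff_infty.1 hg 2
  have hG₁ : Differentiable ℝ G := hG.differentiable two_ne_zero
  have : (volume : Measure ((Fin N → ℝ) × (Fin N → ℝ))).IsAddHaarMeasure :=
    Measure.prod.instIsAddHaarMeasure volume volume
  have hterm (i : Fin N) := integral_langevin_divergence_form
    (μ := (volume : Measure ((Fin N → ℝ) × (Fin N → ℝ)))) (contDiff_gibbsDensity hU) hG hgsupp γ
    (Pi.single i 1, 0) (0, Pi.single i 1)
  rw [← Finset.sum_eq_zero (s := univ) fun i _ => (hterm i).2,
    ← integral_finsetSum _ fun i _ => (hterm i).1]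
  congr 1 with p
  have hx (i : Fin N) : deriv (fun s => g (Function.update p.1 i s) p.2) (p.1 i) =
      fderiv ℝ G p (Pi.single i 1, 0) := by
    simpa using (hasDerivAt_comp_update_fst hG₁ p.1 p.2 i (p.1 i)).deriv
  have hv (i : Fin N) : deriv (fun s => g p.1 (Function.update p.2 i s)) (p.2 i) =
      fderiv ℝ G p (0, Pi.single i 1) := by
    simpa using (hasDerivAt_comp_update_snd hG₁ p.1 p.2 i (p.2 i)).deriv
  have hvv (i : Fin N) : iteratedDeriv 2 (fun s => g p.1 (Function.update p.2 i s)) (p.2 i) =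
      fderiv ℝ (fun q => fderiv ℝ G q (0, Pi.single i 1)) p (0, Pi.single i 1) :=
    iteratedDeriv_two_comp_update_snd hG p.1 p.2 i
  simp_rw [hx, hv, hvv, fderiv_gibbsDensity_fst hU, fderiv_gibbsDensity_snd hU]
  change _ * gibbsDensity U p = _
  rw [mul_sum, ← sum_sub_distrib, ← sum_add_distrib, sum_mul]
  exact sum_congr rfl fun i _ => by ring
end

section
/- Let γ > 0, set a = min(γ, 1/γ)/2 and b = 1 + a² − aγ, and let M = [[1, −a], [−a, b + a²]] and J₀ = [[0, 1], [−1, −γ]]. Then M is positive definite and, for every u ∈ ℝ², ⟨u, M⁻¹ J₀ u⟩ ≤ −(a/8) ⟨u, M⁻¹ u⟩. -/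
open Matrix

/-- with `a = min(γ,1/γ)/2`, `b = 1 + a² - aγ`,
`M = [[1,-a],[-a,b+a²]]` and `J₀ = [[0,1],[-1,-γ]]`, the matrix `M` is positive
definite and `⟨u, M⁻¹ J₀ u⟩ ≤ -(a/8) ⟨u, M⁻¹ u⟩` for all `u ∈ ℝ²`. -/
theorem fisher_matrix_contraction (γ : ℝ) (hγ : 0 < γ)
    (a b : ℝ) (ha : a = min γ γ⁻¹ / 2) (hb : b = 1 + a ^ 2 - a * γ)
    (M J₀ : Matrix (Fin 2) (Fin 2) ℝ)
    (hM : M = !![1, -a; -a, b + a ^ 2])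
    (hJ : J₀ = !![0, 1; -1, -γ]) :
    M.PosDef ∧
      ∀ u : Fin 2 → ℝ,
        u ⬝ᵥ (M⁻¹ *ᵥ (J₀ *ᵥ u)) ≤ -(a / 8) * (u ⬝ᵥ (M⁻¹ *ᵥ u)) := by
  have ha0 : 0 < a := by rw [ha]; positivity
  have hγa : 2 * a ≤ γ := by linarith [min_le_left γ γ⁻¹]
  have haγ : a * γ ≤ 1 / 2 := by
    have h : 2 * a ≤ γ⁻¹ := by linarith [min_le_right γ γ⁻¹]
    have h' := mul_le_mul_of_nonneg_right h hγ.le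
    rw [inv_mul_cancel₀ hγ.ne'] at h'
    linarith
  have hb0 : 0 < b := by nlinarith
  refine ⟨?_, fun u ↦ ?_⟩
  · subst hM
    refine .of_dotProduct_mulVec_pos ?_ fun x hx ↦ ?_
    · ext i j
      fin_cases i <;> fin_cases j <;> simp
    · have hsq : star x ⬝ᵥ (!![1, -a; -a, b + a ^ 2] *ᵥ x)
          = (x 0 - a * x 1) ^ 2 + b * x 1 ^ 2 := by
        simp [mulVec, dotProduct, Fin.sum_univ_two]
        ring
      rw [hsq]
      by_cases h1 : x 1 = 0
      · have h0 : x 0 ≠ 0 := fun h0 ↦ hx (by ext i; fin_cases i <;> simp [h0, h1])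
        rw [h1]
        simp only [mul_zero, sub_zero]
        positivity
      · positivity
  · have hinv : M⁻¹ = b⁻¹ • !![b + a ^ 2, a; a, 1] := by
      refine inv_eq_right_inv ?_
      rw [hM]
      ext i j
      fin_cases i <;> fin_cases j <;> simp [Matrix.mul_apply, Fin.sum_univ_two] <;>
        field_simp <;> ring
    rw [hinv, hJ, smul_mulVec, smul_mulVec, dotProduct_smul, dotProduct_smul, smul_eq_mul,
      smul_eq_mul, mul_left_comm]
    refine mul_le_mul_of_nonneg_left ?_ (inv_nonneg.2 hb0.le)
    -- Complete the square in the difference of the two quadratic forms.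
    have hk : 0 ≤ (γ - 9 * a / 8) * (u 1 + a * u 0) ^ 2 :=
      mul_nonneg (by linarith) (sq_nonneg _)
    have hp : 0 ≤ a * (1 - (b + a ^ 2) / 8 - a * (γ - 9 * a / 8)) * u 0 ^ 2 :=
      mul_nonneg (mul_nonneg ha0.le (by nlinarith)) (sq_nonneg _)
    simp only [mulVec, dotProduct, Fin.sum_univ_two, of_apply, cons_val_zero, cons_val_one,
      cons_val', cons_val_fin_one]
    subst hb
    linarith
end

section
/- Let γ > 0, set a = min(γ, 1/γ)/2 and b = 1 + a² − aγ, and let M = [[1, −a], [−a, b + a²]]. Then for every u ∈ ℝ², (1/2) |u|² ≤ ⟨u, M u⟩ ≤ 2 |u|². -/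
open Matrix Finset

/-- with `a = min(γ,1/γ)/2`, `b = 1 + a² - aγ` and
`M = [[1,-a],[-a,b+a²]]`, the modified norm satisfies
`(1/2)|u|² ≤ ⟨u, Mu⟩ ≤ 2|u|²` for all `u ∈ ℝ²`. -/
theorem modified_norm_equivalence (γ : ℝ) (hγ : 0 < γ)
    (a b : ℝ) (ha : a = min γ γ⁻¹ / 2) (hb : b = 1 + a ^ 2 - a * γ)
    (M : Matrix (Fin 2) (Fin 2) ℝ) (hM : M = !![1, -a; -a, b + a ^ 2]) :
    ∀ u : Fin 2 → ℝ,
      (1 / 2) * ∑ i, (u i) ^ 2 ≤ u ⬝ᵥ (M *ᵥ u) ∧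
        u ⬝ᵥ (M *ᵥ u) ≤ 2 * ∑ i, (u i) ^ 2 := by
  intro u
  have ha_pos : 0 < a := by rw [ha]; positivity
  have ha_le : 2 * a ≤ γ := by linarith [min_le_left γ γ⁻¹]
  have ha_le_inv : 2 * a ≤ γ⁻¹ := by linarith [min_le_right γ γ⁻¹]
  have haγ : 2 * (a * γ) ≤ 1 := by
    have h := mul_le_mul_of_nonneg_right ha_le_inv hγ.le
    rw [inv_mul_cancel₀ hγ.ne'] at h
    linarith
  have hsq : 2 * a ^ 2 ≤ a * γ := by nlinarith
  have hform : u ⬝ᵥ (M *ᵥ u) =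
      u 0 ^ 2 - 2 * a * (u 0 * u 1) + (1 + 2 * a ^ 2 - a * γ) * u 1 ^ 2 := by
    simp [hM, hb, dotProduct, mulVec, Fin.sum_univ_two]
    ring
  rw [hform, Fin.sum_univ_two]
  constructor
  · nlinarith [sq_nonneg (u 0 - 2 * a * u 1),
      mul_nonneg (sub_nonneg.2 haγ) (sq_nonneg (u 1))]
  · nlinarith [sq_nonneg (u 0 + a * u 1),
      mul_nonneg (sub_nonneg.2 hsq) (sq_nonneg (u 1)),
      mul_nonneg (show 0 ≤ 1 - a ^ 2 by linarith) (sq_nonneg (u 1))]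
end

section
/- Let γ > 0, set a = min(γ, 1/γ)/2 and b = 1 + a² − aγ, and let M = [[1, −a], [−a, b + a²]] and J₀ = [[0, 1], [−1, −γ]]. There exists λ₀ > 0 (depending only on γ) such that for every λ' ∈ [0, λ₀] there exists θ > 0 such that for all u = (u₁, u₂) ∈ ℝ², ⟨u, M⁻¹ (J₀ + λ' θ I) u⟩ + (λ'/θ) u₂² ≤ −(a/8) ⟨u, M⁻¹ u⟩, where I is the 2×2 identity matrix. -/
open Matrix

/-- Unperturbed contraction at rate `a / 4`, after clearing the determinant `b = 1 + a ^ 2 - a * γ`. -/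
lemma quadForm_contraction {γ a : ℝ} (ha : 0 < a) (h2 : 2 * a ≤ γ) (haγ : a * γ ≤ 1 / 2) (x y : ℝ) :
    -a * x ^ 2 + (2 * a ^ 2 - 2 * a * γ) * (x * y) + (a - γ) * y ^ 2
      ≤ -(a / 4) * ((1 + 2 * a ^ 2 - a * γ) * x ^ 2 + 2 * a * (x * y) + y ^ 2) := by
  have hd : 0 ≤ γ - 5 * a / 4 := by linarith
  have hsq : 0 ≤ (γ - 5 * a / 4) * (y + a * x) ^ 2 := mul_nonneg hd (sq_nonneg _)
  have haa : 0 ≤ a * (γ - 2 * a) := mul_nonneg ha.le (by linarith)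
  have hx : 0 ≤ a * x ^ 2 * (3 / 4 + a * (γ - 2 * a) / 4 - a * (γ - 5 * a / 4)) := by
    apply mul_nonneg (by positivity)
    nlinarith [sq_nonneg a]
  linarith

/-- Control of `y ^ 2` by the quadratic form with matrix `b • M⁻¹`. -/
lemma sq_le_two_mul_quadForm {γ a : ℝ} (haγ : a * γ ≤ 1 / 2) (x y : ℝ) :
    y ^ 2 ≤ 2 * ((1 + 2 * a ^ 2 - a * γ) * x ^ 2 + 2 * a * (x * y) + y ^ 2) := by
  have hx : 0 ≤ (2 - 2 * (a * γ)) * x ^ 2 := mul_nonneg (by linarith) (sq_nonneg x)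
  nlinarith [sq_nonneg (y + 2 * a * x)]

/-- perturbed quadratic-form inequality: for small enough `λ'`
there exists `θ > 0` such that
`⟨u, M⁻¹(J₀ + λ'θ I)u⟩ + (λ'/θ)u₂² ≤ -(a/8)⟨u, M⁻¹u⟩` for all `u ∈ ℝ²`. -/
theorem perturbed_fisher_matrix_contraction (γ : ℝ) (hγ : 0 < γ)
    (a b : ℝ) (ha : a = min γ γ⁻¹ / 2) (hb : b = 1 + a ^ 2 - a * γ)
    (M J₀ : Matrix (Fin 2) (Fin 2) ℝ)
    (hM : M = !![1, -a; -a, b + a ^ 2])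
    (hJ : J₀ = !![0, 1; -1, -γ]) :
    ∃ lam₀ > (0 : ℝ), ∀ lam' : ℝ, lam' ∈ Set.Icc 0 lam₀ → ∃ θ > (0 : ℝ),
      ∀ u : Fin 2 → ℝ,
        u ⬝ᵥ (M⁻¹ *ᵥ ((J₀ + (lam' * θ) • (1 : Matrix (Fin 2) (Fin 2) ℝ)) *ᵥ u))
            + (lam' / θ) * (u 1) ^ 2
          ≤ -(a / 8) * (u ⬝ᵥ (M⁻¹ *ᵥ u)) := by
  have hmin : 0 < min γ γ⁻¹ := lt_min hγ (inv_pos.mpr hγ)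
  have ha0 : 0 < a := by rw [ha]; linarith
  have h2 : 2 * a ≤ γ := by rw [ha]; linarith [min_le_left γ γ⁻¹]
  have haγ : a * γ ≤ 1 / 2 := by
    have h := mul_le_mul_of_nonneg_right (min_le_right γ γ⁻¹) hγ.le
    rw [inv_mul_cancel₀ hγ.ne'] at h
    rw [ha]
    linarith
  have hb0 : 0 < b := by rw [hb]; nlinarith [sq_nonneg a]
  have hb1 : b ≤ 1 := by rw [hb]; nlinarith
  have hinv : M⁻¹ = b⁻¹ • !![b + a ^ 2, a; a, 1] := by
    have hdet : M.det = b := by rw [hM, det_fin_two_of]; ring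
    rw [inv_def, hdet, Ring.inverse_eq_inv', hM, adjugate_fin_two_of, neg_neg]
  refine ⟨a / 24, by positivity, fun l ⟨hl0, hl⟩ => ⟨1, one_pos, fun u => ?_⟩⟩
  have hc := quadForm_contraction ha0 h2 haγ (u 0) (u 1)
  have hy := sq_le_two_mul_quadForm haγ (u 0) (u 1)
  have hS : b + a ^ 2 = 1 + 2 * a ^ 2 - a * γ := by rw [hb]; ring
  set S := (1 + 2 * a ^ 2 - a * γ) * u 0 ^ 2 + 2 * a * (u 0 * u 1) + u 1 ^ 2 with hSdef
  set N := -a * u 0 ^ 2 + (2 * a ^ 2 - 2 * a * γ) * (u 0 * u 1) + (a - γ) * u 1 ^ 2 with hNdef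
  have hQ : u ⬝ᵥ (M⁻¹ *ᵥ u) = b⁻¹ * S := by
    rw [hinv, hS, hSdef]
    simp [dotProduct, mulVec, Fin.sum_univ_two]
    ring
  have hJQ : u ⬝ᵥ (M⁻¹ *ᵥ (J₀ *ᵥ u)) = b⁻¹ * N := by
    rw [hinv, hS, hJ, hNdef]
    simp [dotProduct, mulVec, Fin.sum_univ_two]
    ring
  rw [add_mulVec, smul_mulVec, one_mulVec, mulVec_add, mulVec_smul, dotProduct_add,
    dotProduct_smul, hQ, hJQ, smul_eq_mul, mul_one, div_one]
  have hS0 : 0 ≤ S := by nlinarith [sq_nonneg (u 1)]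
  have hby : b * u 1 ^ 2 ≤ 2 * S :=
    (mul_le_of_le_one_left (sq_nonneg _) hb1).trans hy
  have hlS : l * S ≤ a / 24 * S := mul_le_mul_of_nonneg_right hl hS0
  have hlby := mul_le_mul_of_nonneg_left hby hl0
  have hmain : N + l * S + l * (b * u 1 ^ 2) ≤ -(a / 8) * S := by linarith
  have h := mul_le_mul_of_nonneg_left hmain (inv_pos.mpr hb0).le
  have hcancel : b⁻¹ * (l * (b * u 1 ^ 2)) = l * u 1 ^ 2 := by field_simp
  linarith
end
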